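/- (Main Theorem) Let (Ω, B(Ω), μ, T) be a measure-preserving dynamical system with Ω ⊆ ℝ a compact metric space. Suppose T is aperiodic and countable piecewise monotone with a countable partition M into monotony intervals satisfying H(M) < ∞. Then the permutation entropy equals the Kolmogorov-Sinai entropy: h^{PE}(T) = h(T). -/

import Mathlib

open MeasureTheory Real Filter
open scoped symmDiff

noncomputable def shEntropy {α I : Type*} [MeasurableSpace α] (μ : Measure α) (P : I → Set α) : ℝ :=
  ∑' i, Real.negMulLog (μ (P i)).toReal

def IsPartitionOf {I : Type*} (Ω : Set ℝ) (P : I → Set ℝ) : Prop :=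
  (Pairwise fun i j => Disjoint (P i) (P j)) ∧ (⋃ i, P i) = Ω

def IsIntervalIn (Ω A : Set ℝ) : Prop :=
  A ⊆ Ω ∧ ∀ x ∈ A, ∀ z ∈ A, ∀ y ∈ Ω, x ≤ y → y ≤ z → y ∈ A

def IsMonotonyPartition {I : Type*} (Ω : Set ℝ) (T : ℝ → ℝ) (M : I → Set ℝ) : Prop :=
  IsPartitionOf Ω M ∧ ∀ i, IsIntervalIn Ω (M i) ∧ (MonotoneOn T (M i) ∨ StrictAntiOn T (M i))

def multiCell {I : Type*} (T : ℝ → ℝ) (P : I → Set ℝ) (n : ℕ) (a : Fin n → I) : Set ℝ :=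
  ⋂ k : Fin n, T^[(k : ℕ)] ⁻¹' P (a k)

def ordCell (Ω : Set ℝ) (T : ℝ → ℝ) (n : ℕ) (pp : Equiv.Perm (Fin n)) : Set ℝ :=
  {ω ∈ Ω | ∀ k l : Fin n, k ≤ l → T^[((pp k : Fin n) : ℕ)] ω ≤ T^[((pp l : Fin n) : ℕ)] ω}

noncomputable def entropyRate {I : Type*} (μ : Measure ℝ) (T : ℝ → ℝ) (P : I → Set ℝ) : ℝ :=
  liminf (fun n : ℕ => shEntropy μ (multiCell T P n) / (n : ℝ)) atTop

noncomputable def permEntropy (Ω : Set ℝ) (μ : Measure ℝ) (T : ℝ → ℝ) : ℝ :=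
  liminf (fun n : ℕ => shEntropy μ (ordCell Ω T n) / (n : ℝ)) atTop

noncomputable def ksEntropy (Ω : Set ℝ) (μ : Measure ℝ) (T : ℝ → ℝ) : ℝ :=
  sSup {h : ℝ | ∃ P : ℕ → Set ℝ, IsPartitionOf Ω P ∧ (∀ i, MeasurableSet (P i)) ∧
    (Summable fun i => Real.negMulLog (μ (P i)).toReal) ∧ h = entropyRate μ T P}

def Aperiodic (μ : Measure ℝ) (T : ℝ → ℝ) : Prop :=
  μ {ω | ∃ t, 1 ≤ t ∧ T^[t] ω = ω} = 0

section Entropy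

open scoped ENNReal

variable {α ι κ : Type*} [MeasurableSpace α] {μ : Measure α}

/-- Entropy, valued in `[0, ∞]`, of a function with countably many values. -/
noncomputable def eEntropy (μ : Measure α) (X : α → ι) : ℝ≥0∞ :=
  ∑' i, ENNReal.ofReal (negMulLog (μ.real (X ⁻¹' {i})))

/-- All level sets of `X` are measurable. -/
def MeasurableFibers (X : α → ι) : Prop :=
  ∀ i, MeasurableSet (X ⁻¹' {i})

theorem MeasurableFibers.preimage [Countable ι] {X : α → ι} (hX : MeasurableFibers X)
    (s : Set ι) : MeasurableSet (X ⁻¹' s) := by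
  rw [← Set.biUnion_preimage_singleton]
  exact MeasurableSet.biUnion s.to_countable fun i _ => hX i

theorem MeasurableFibers.prodMk {X : α → ι} {Y : α → κ} (hX : MeasurableFibers X)
    (hY : MeasurableFibers Y) : MeasurableFibers fun ω => (X ω, Y ω) := by
  rintro ⟨i, j⟩
  convert (hX i).inter (hY j) using 1
  ext ω
  simp

theorem MeasurableFibers.pi {ν : Type*} [Finite ν] {X : ν → α → ι}
    (hX : ∀ k, MeasurableFibers (X k)) : MeasurableFibers fun ω k => X k ω := by
  intro a
  convert MeasurableSet.iInter fun k => hX k (a k) using 1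
  ext ω
  simp [funext_iff]

theorem MeasurableFibers.comp {β : Type*} [MeasurableSpace β] {X : β → ι}
    (hX : MeasurableFibers X) {f : α → β} (hf : Measurable f) :
    MeasurableFibers fun ω => X (f ω) :=
  fun i => hf (hX i)

theorem tsum_measure_inter_fiber [Countable ι] {X : α → ι} (hX : MeasurableFibers X)
    {A : Set α} (hA : MeasurableSet A) : ∑' i, μ (A ∩ X ⁻¹' {i}) = μ A := by
  rw [← measure_iUnion]
  · congr 1
    ext ω
    simp
  · intro i j hij
    refine Set.disjoint_left.2 fun ω h₁ h₂ => hij ?_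
    have h₁ := h₁.2
    have h₂ := h₂.2
    simp only [Set.mem_preimage, Set.mem_singleton_iff] at h₁ h₂
    rw [← h₁, ← h₂]
  · exact fun i => hA.inter (hX i)

theorem tsum_measure_fiber_mul [Countable ι] {X : α → ι} (hX : MeasurableFibers X)
    (g : ι → ℝ≥0∞) : ∑' i, μ (X ⁻¹' {i}) * g i = ∫⁻ ω, g (X ω) ∂μ := by
  let _ : MeasurableSpace ι := ⊤
  have hm : Measurable X := fun s _ => hX.preimage s
  rw [← lintegral_map (μ := μ) (f := g) measurable_from_top hm, lintegral_countable']
  refine tsum_congr fun i => ?_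
  rw [Measure.map_apply hm trivial, mul_comm]

theorem negMulLog_add_le {p q : ℝ} (hp : 0 ≤ p) (hq : 0 ≤ q) (h : q = 0 → p = 0) :
    negMulLog p + p ≤ p * (-log q) + q := by
  rcases hp.eq_or_lt with rfl | hp
  · simpa using hq
  have hq : 0 < q := hq.lt_of_ne fun h' => hp.ne' (h h'.symm)
  have h₁ := mul_le_mul_of_nonneg_left (log_le_sub_one_of_pos (div_pos hq hp)) hp.le
  rw [log_div hq.ne' hp.ne', mul_sub, mul_sub, mul_div_cancel₀ _ hp.ne'] at h₁
  rw [negMulLog]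
  linarith

/-- If `Y` takes at most `#(F i)` values where `X = i`, then the entropy of `Y` exceeds that of
`X` by at most the mean of `log #(F X)`. -/
theorem eEntropy_le_add_lintegral [Countable ι] [Countable κ] [IsProbabilityMeasure μ]
    {X : α → ι} {Y : α → κ} (hX : MeasurableFibers X) (hY : MeasurableFibers Y)
    (F : ι → Finset κ) (hF : ∀ᵐ ω ∂μ, Y ω ∈ F (X ω)) :
    eEntropy μ Y ≤ eEntropy μ X + ∫⁻ ω, ENNReal.ofReal (log (F (X ω)).card) ∂μ := by
  set p : ι → κ → ℝ := fun i j => μ.real (X ⁻¹' {i} ∩ Y ⁻¹' {j}) with hp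
  have hpF : ∀ i j, j ∉ F i → p i j = 0 := by
    intro i j hj
    have : μ (X ⁻¹' {i} ∩ Y ⁻¹' {j}) = 0 := by
      refine measure_mono_null ?_ hF
      rintro ω ⟨h₁, h₂⟩
      simp only [Set.mem_preimage, Set.mem_singleton_iff] at h₁ h₂
      simp [h₁, h₂, hj]
    simp [hp, measureReal_def, this]
  have hsumY : ∀ j, ∑' i, ENNReal.ofReal (p i j) = μ (Y ⁻¹' {j}) := by
    intro j
    rw [← tsum_measure_inter_fiber hX (hY j)]
    refine tsum_congr fun i => ?_
    rw [hp, ofReal_measureReal, Set.inter_comm]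
  have hsumX : ∀ i, ∑' j, ENNReal.ofReal (p i j) = μ (X ⁻¹' {i}) := by
    intro i
    rw [← tsum_measure_inter_fiber hY (hX i)]
    refine tsum_congr fun j => ?_
    rw [hp, ofReal_measureReal]
  have h₁ : ∀ j, ENNReal.ofReal (negMulLog (μ.real (Y ⁻¹' {j})))
      ≤ ∑' i, ENNReal.ofReal (negMulLog (p i j)) := by
    intro j
    have : ENNReal.ofReal (negMulLog (μ.real (Y ⁻¹' {j})))
        = ∑' i, ENNReal.ofReal (p i j) * ENNReal.ofReal (-log (μ.real (Y ⁻¹' {j}))) := by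
      rw [ENNReal.tsum_mul_right, hsumY, negMulLog, neg_mul, ← mul_neg,
        ENNReal.ofReal_mul measureReal_nonneg, ofReal_measureReal]
    rw [this]
    refine ENNReal.tsum_le_tsum fun i => ?_
    rw [negMulLog, neg_mul, ← mul_neg, ENNReal.ofReal_mul measureReal_nonneg]
    rcases (measureReal_nonneg : 0 ≤ p i j).eq_or_lt with h | h
    · rw [ENNReal.ofReal_of_nonpos h.ge, zero_mul]
      exact zero_le
    gcongr
    exact measureReal_mono Set.inter_subset_right
  have h₂ : ∀ i, ∑' j, ENNReal.ofReal (negMulLog (p i j))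
      ≤ ENNReal.ofReal (negMulLog (μ.real (X ⁻¹' {i})))
        + μ (X ⁻¹' {i}) * ENNReal.ofReal (log (F i).card) := by
    intro i
    set P := μ.real (X ⁻¹' {i}) with hP
    rw [tsum_eq_sum (s := F i) fun j hj => by simp [hpF i j hj]]
    have hp0 : ∀ j, 0 ≤ p i j := fun j => measureReal_nonneg
    have hp1 : ∀ j, p i j ≤ 1 := fun j => measureReal_le_one
    have hP0 : 0 ≤ P := measureReal_nonneg
    have hP1 : P ≤ 1 := measureReal_le_one
    have hsum : ∑ j ∈ F i, p i j = P := by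
      have := hsumX i
      rw [tsum_eq_sum (s := F i) fun j hj => by simp [hpF i j hj],
        ← ENNReal.ofReal_sum_of_nonneg fun j _ => hp0 j] at this
      rw [hP, measureReal_def, ← this, ENNReal.toReal_ofReal (Finset.sum_nonneg fun j _ => hp0 j)]
    have hlog : 0 ≤ log ((F i).card : ℝ) := log_natCast_nonneg _
    rw [← ENNReal.ofReal_sum_of_nonneg fun j _ => negMulLog_nonneg (hp0 j) (hp1 j),
      ← ofReal_measureReal (μ := μ) (s := X ⁻¹' {i}), ← hP, ← ENNReal.ofReal_mul hP0,
      ← ENNReal.ofReal_add (negMulLog_nonneg hP0 hP1) (mul_nonneg hP0 hlog)]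
    refine ENNReal.ofReal_le_ofReal ?_
    rcases hP0.eq_or_lt with h0 | h0
    · have : ∀ j ∈ F i, p i j = 0 := by
        rwa [← h0, Finset.sum_eq_zero_iff_of_nonneg fun j _ => hp0 j] at hsum
      rw [Finset.sum_eq_zero fun j hj => by rw [this j hj, negMulLog_zero], ← h0]
      simp
    have hcard : 0 < ((F i).card : ℝ) := by
      rw [Nat.cast_pos, Finset.card_pos, Finset.nonempty_iff_ne_empty]
      intro h
      rw [h, Finset.sum_empty] at hsum
      exact h0.ne hsum
    have hq : 0 < P / (F i).card := div_pos h0 hcard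
    have := Finset.sum_le_sum fun j (_ : j ∈ F i) =>
      negMulLog_add_le (hp0 j) hq.le fun h => absurd h hq.ne'
    rw [Finset.sum_add_distrib, Finset.sum_add_distrib, ← Finset.sum_mul, hsum,
      Finset.sum_const, nsmul_eq_mul, mul_div_cancel₀ _ hcard.ne',
      log_div h0.ne' hcard.ne'] at this
    rw [negMulLog] at *
    linarith
  calc eEntropy μ Y ≤ ∑' j, ∑' i, ENNReal.ofReal (negMulLog (p i j)) := ENNReal.tsum_le_tsum h₁
    _ = ∑' i, ∑' j, ENNReal.ofReal (negMulLog (p i j)) := ENNReal.tsum_comm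
    _ ≤ ∑' i, (ENNReal.ofReal (negMulLog (μ.real (X ⁻¹' {i})))
        + μ (X ⁻¹' {i}) * ENNReal.ofReal (log (F i).card)) := ENNReal.tsum_le_tsum h₂
    _ = _ := by
      rw [ENNReal.tsum_add,
        tsum_measure_fiber_mul hX fun i => ENNReal.ofReal (log (F i).card), eEntropy]

theorem eEntropy_mono [Countable ι] [Countable κ] [IsProbabilityMeasure μ]
    {X : α → ι} {Y : α → κ} (hX : MeasurableFibers X) (hY : MeasurableFibers Y)
    (h : ∀ ω ω', X ω = X ω' → Y ω = Y ω') : eEntropy μ Y ≤ eEntropy μ X := by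
  classical
  let F : ι → Finset κ := fun i => if h : ∃ ω, X ω = i then {Y h.choose} else ∅
  have hF : ∀ ω, F (X ω) = {Y ω} := by
    intro ω
    have hex : ∃ ω', X ω' = X ω := ⟨ω, rfl⟩
    simp only [F, dif_pos hex]
    rw [h _ _ hex.choose_spec]
  have := eEntropy_le_add_lintegral (μ := μ) hX hY F (.of_forall fun ω => by simp [hF])
  simpa [hF] using this

theorem eEntropy_le_log_card [Countable κ] [IsProbabilityMeasure μ]
    {Y : α → κ} (hY : MeasurableFibers Y) (F : Finset κ) (hF : ∀ᵐ ω ∂μ, Y ω ∈ F) :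
    eEntropy μ Y ≤ ENNReal.ofReal (log F.card) := by
  have := eEntropy_le_add_lintegral (μ := μ) (X := fun _ : α => ())
    (fun i => by simp) hY (fun _ => F) hF
  have h0 : eEntropy μ (fun _ : α => ()) = 0 := by simp [eEntropy]
  simpa [h0] using this

theorem eEntropy_prodMk_le [Countable ι] [Countable κ] [IsProbabilityMeasure μ]
    {X : α → ι} {Y : α → κ} (hX : MeasurableFibers X) (hY : MeasurableFibers Y) :
    eEntropy μ (fun ω => (X ω, Y ω)) ≤ eEntropy μ X + eEntropy μ Y := by
  set P : ι → ℝ := fun i => μ.real (X ⁻¹' {i}) with hP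
  set Q : κ → ℝ := fun j => μ.real (Y ⁻¹' {j}) with hQ
  set p : ι → κ → ℝ := fun i j => μ.real (X ⁻¹' {i} ∩ Y ⁻¹' {j}) with hp
  have hp0 : ∀ i j, 0 ≤ p i j := fun i j => measureReal_nonneg
  have hp1 : ∀ i j, p i j ≤ 1 := fun i j => measureReal_le_one
  have hP0 : ∀ i, 0 ≤ P i := fun i => measureReal_nonneg
  have hQ0 : ∀ i, 0 ≤ Q i := fun i => measureReal_nonneg
  have hsumY : ∀ j, ∑' i, ENNReal.ofReal (p i j) = ENNReal.ofReal (Q j) := by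
    intro j
    rw [hQ, ofReal_measureReal, ← tsum_measure_inter_fiber hX (hY j)]
    refine tsum_congr fun i => ?_
    rw [hp, ofReal_measureReal, Set.inter_comm]
  have hsumX : ∀ i, ∑' j, ENNReal.ofReal (p i j) = ENNReal.ofReal (P i) := by
    intro i
    rw [hP, ofReal_measureReal, ← tsum_measure_inter_fiber hY (hX i)]
    refine tsum_congr fun j => ?_
    rw [hp, ofReal_measureReal]
  have hsumP : ∑' i, ENNReal.ofReal (P i) = 1 := by
    have := tsum_measure_inter_fiber (μ := μ) hX MeasurableSet.univ
    simp only [Set.univ_inter, measure_univ] at this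
    rw [← this]
    exact tsum_congr fun i => ofReal_measureReal
  have hsumQ : ∑' i, ENNReal.ofReal (Q i) = 1 := by
    have := tsum_measure_inter_fiber (μ := μ) hY MeasurableSet.univ
    simp only [Set.univ_inter, measure_univ] at this
    rw [← this]
    exact tsum_congr fun i => ofReal_measureReal
  have key : ∀ i j, ENNReal.ofReal (negMulLog (p i j)) + ENNReal.ofReal (p i j)
      ≤ ENNReal.ofReal (p i j) * ENNReal.ofReal (-log (P i))
        + ENNReal.ofReal (p i j) * ENNReal.ofReal (-log (Q j))
        + ENNReal.ofReal (P i) * ENNReal.ofReal (Q j) := by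
    intro i j
    have hpP : p i j ≤ P i := measureReal_mono Set.inter_subset_left
    have hpQ : p i j ≤ Q j := measureReal_mono Set.inter_subset_right
    have hlP : 0 ≤ -log (P i) := neg_nonneg.2 (log_nonpos (hP0 i) measureReal_le_one)
    have hlQ : 0 ≤ -log (Q j) := neg_nonneg.2 (log_nonpos (hQ0 j) measureReal_le_one)
    rw [← ENNReal.ofReal_add (negMulLog_nonneg (hp0 i j) (hp1 i j)) (hp0 i j),
      ← ENNReal.ofReal_mul (hp0 i j), ← ENNReal.ofReal_mul (hp0 i j),
      ← ENNReal.ofReal_mul (hP0 i),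
      ← ENNReal.ofReal_add (mul_nonneg (hp0 i j) hlP) (mul_nonneg (hp0 i j) hlQ),
      ← ENNReal.ofReal_add (add_nonneg (mul_nonneg (hp0 i j) hlP) (mul_nonneg (hp0 i j) hlQ))
        (mul_nonneg (hP0 i) (hQ0 j))]
    refine ENNReal.ofReal_le_ofReal ?_
    rcases (hp0 i j).eq_or_lt with h | h
    · rw [← h]
      simpa using mul_nonneg (hP0 i) (hQ0 j)
    have hPp : 0 < P i := h.trans_le hpP
    have hQp : 0 < Q j := h.trans_le hpQ
    have := negMulLog_add_le (hp0 i j) (mul_pos hPp hQp).le fun h' =>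
      absurd h' (mul_pos hPp hQp).ne'
    rw [log_mul hPp.ne' hQp.ne'] at this
    linarith
  have hnml : ∀ x : ℝ, 0 ≤ x → ENNReal.ofReal (negMulLog x)
      = ENNReal.ofReal x * ENNReal.ofReal (-log x) := by
    intro x hx
    rw [negMulLog, neg_mul, ← mul_neg, ENNReal.ofReal_mul hx]
  have h := ENNReal.tsum_le_tsum fun i => ENNReal.tsum_le_tsum fun j => key i j
  have e₁ : ∑' i, ∑' j, ENNReal.ofReal (p i j) * ENNReal.ofReal (-log (P i)) = eEntropy μ X := by
    refine tsum_congr fun i => ?_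
    rw [ENNReal.tsum_mul_right, hsumX, hnml _ measureReal_nonneg]
  have e₂ : ∑' i, ∑' j, ENNReal.ofReal (p i j) * ENNReal.ofReal (-log (Q j)) = eEntropy μ Y := by
    rw [ENNReal.tsum_comm]
    refine tsum_congr fun j => ?_
    rw [ENNReal.tsum_mul_right, hsumY, hnml _ measureReal_nonneg]
  have e₃ : ∑' i, ∑' j, ENNReal.ofReal (P i) * ENNReal.ofReal (Q j) = 1 := by
    simp only [ENNReal.tsum_mul_left, hsumQ, mul_one, hsumP]
  have e₄ : ∑' i, ∑' j, ENNReal.ofReal (p i j) = 1 := by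
    simp only [hsumX, hsumP]
  have e₅ : ∑' i, ∑' j, ENNReal.ofReal (negMulLog (p i j))
      = eEntropy μ (fun ω => (X ω, Y ω)) := by
    rw [eEntropy, ENNReal.tsum_prod']
    refine tsum_congr fun i => tsum_congr fun j => ?_
    have : (fun ω => (X ω, Y ω)) ⁻¹' {(i, j)} = X ⁻¹' {i} ∩ Y ⁻¹' {j} := by
      ext ω
      simp
    rw [this]
  simp only [ENNReal.tsum_add] at h
  rw [e₁, e₂, e₃, e₄, e₅] at h
  exact (ENNReal.add_le_add_iff_right ENNReal.one_ne_top).1 h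

theorem eEntropy_pi_le [Countable ι] [IsProbabilityMeasure μ] {n : ℕ} {X : Fin n → α → ι}
    (hX : ∀ k, MeasurableFibers (X k)) :
    eEntropy μ (fun ω k => X k ω) ≤ ∑ k, eEntropy μ (X k) := by
  induction n with
  | zero =>
    refine (eEntropy_mono (X := fun _ : α => ()) (fun i => by simp) (MeasurableFibers.pi hX)
      fun _ _ _ => Subsingleton.elim _ _).trans ?_
    simp [eEntropy]
  | succ n ih =>
    rw [Fin.sum_univ_succ]
    have hpi := MeasurableFibers.pi fun k : Fin n => hX k.succ
    refine (eEntropy_mono ((hX 0).prodMk hpi) (MeasurableFibers.pi hX) ?_).trans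
      ((eEntropy_prodMk_le (hX 0) hpi).trans (by gcongr; exact ih fun k => hX k.succ))
    intro ω ω' h
    simp only [Prod.mk.injEq, funext_iff] at h
    funext k
    exact Fin.cases h.1 h.2 k

theorem eEntropy_comp_measurePreserving {f : α → α} (hf : MeasurePreserving f μ μ) {X : α → ι}
    (hX : MeasurableFibers X) : eEntropy μ (fun ω => X (f ω)) = eEntropy μ X := by
  refine tsum_congr fun i => ?_
  have : (fun ω => X (f ω)) ⁻¹' {i} = f ⁻¹' (X ⁻¹' {i}) := rfl
  rw [this, measureReal_def, hf.measure_preimage (hX i).nullMeasurableSet, measureReal_def]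

theorem eEntropy_eq_ofReal_shEntropy [IsProbabilityMeasure μ] {X : α → ι} {P : ι → Set α}
    (h : ∀ i, μ (P i) = μ (X ⁻¹' {i})) (hs : Summable fun i => negMulLog (μ (P i)).toReal) :
    eEntropy μ X = ENNReal.ofReal (shEntropy μ P) := by
  rw [shEntropy, ENNReal.ofReal_tsum_of_nonneg _ hs]
  · refine tsum_congr fun i => ?_
    rw [measureReal_def, h]
  · intro i
    exact negMulLog_nonneg measureReal_nonneg measureReal_le_one

theorem shEntropy_eq_toReal_eEntropy [IsProbabilityMeasure μ] {X : α → ι} {P : ι → Set α}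
    (h : ∀ i, μ (P i) = μ (X ⁻¹' {i})) : shEntropy μ P = (eEntropy μ X).toReal := by
  rw [shEntropy, eEntropy, ENNReal.tsum_toReal_eq fun _ => ENNReal.ofReal_ne_top]
  refine tsum_congr fun i => ?_
  rw [ENNReal.toReal_ofReal (negMulLog_nonneg measureReal_nonneg measureReal_le_one),
    measureReal_def, h]

end Entropy

section OrdinalPatterns

open scoped ENNReal

variable {ι κ : Type*}

/-- The ordinal pattern of the first `n` points of the orbit of `ω`. -/
noncomputable def ordPattern (T : ℝ → ℝ) (n : ℕ) (ω : ℝ) : Equiv.Perm (Fin n) :=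
  Tuple.sort fun k : Fin n => T^[(k : ℕ)] ω

/-- The first `n` values of `X` along the orbit of `ω`. -/
def itinerary (T : ℝ → ℝ) (X : ℝ → ι) (n : ℕ) (ω : ℝ) : Fin n → ι :=
  fun k => X (T^[(k : ℕ)] ω)

theorem measurableFibers_ordPattern {T : ℝ → ℝ} (hT : Measurable T) (n : ℕ) :
    MeasurableFibers (ordPattern T n) := by
  intro σ
  have : ordPattern T n ⁻¹' {σ} = {ω | ∀ i j : Fin n, i ≤ j →
      T^[(σ i : ℕ)] ω ≤ T^[(σ j : ℕ)] ω} ∩ {ω | ∀ i j : Fin n, i < j →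
      T^[(σ i : ℕ)] ω = T^[(σ j : ℕ)] ω → σ i < σ j} := by
    ext ω
    exact eq_comm.trans Tuple.eq_sort_iff
  rw [this]
  have hm : ∀ k, Measurable (T^[k]) := fun k => hT.iterate k
  refine MeasurableSet.inter ?_ ?_
  · simp only [Set.ofPred_forall]
    exact .iInter fun i => .iInter fun j => .iInter fun _ => measurableSet_le (hm _) (hm _)
  · simp only [Set.ofPred_forall]
    refine .iInter fun i => .iInter fun j => .iInter fun _ => ?_
    exact (measurableSet_eq_fun (hm _) (hm _)).imp (.const _)

theorem measurableFibers_itinerary {T : ℝ → ℝ} (hT : Measurable T) {X : ℝ → ι}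
    (hX : MeasurableFibers X) (n : ℕ) : MeasurableFibers (itinerary T X n) :=
  .pi fun _ => hX.comp (hT.iterate _)

theorem eEntropy_itinerary_le_mul [Countable ι] {μ : Measure ℝ} [IsProbabilityMeasure μ]
    {T : ℝ → ℝ} (hT : MeasurePreserving T μ μ) {X : ℝ → ι} (hX : MeasurableFibers X) (n : ℕ) :
    eEntropy μ (itinerary T X n) ≤ n * eEntropy μ X := by
  refine (eEntropy_pi_le fun k : Fin n => hX.comp (hT.measurable.iterate k)).trans ?_
  simp [eEntropy_comp_measurePreserving (hT.iterate _) hX]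

theorem Aperiodic.ae_injective {μ : Measure ℝ} {T : ℝ → ℝ} (hap : Aperiodic μ T)
    (hT : MeasurePreserving T μ μ) : ∀ᵐ ω ∂μ, Function.Injective fun k : ℕ => T^[k] ω := by
  have h : ∀ᵐ ω ∂μ, ¬ ∃ t, 1 ≤ t ∧ T^[t] ω = ω := by
    rw [ae_iff]
    simpa [Aperiodic] using hap
  have h' : ∀ᵐ ω ∂μ, ∀ i : ℕ, ¬ ∃ t, 1 ≤ t ∧ T^[t] (T^[i] ω) = T^[i] ω :=
    ae_all_iff.2 fun i => (hT.iterate i).quasiMeasurePreserving.ae h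
  filter_upwards [h'] with ω hω
  have key : ∀ i j, i < j → T^[i] ω ≠ T^[j] ω := by
    intro i j hij he
    refine hω i ⟨j - i, by omega, ?_⟩
    rw [← Function.iterate_add_apply, Nat.sub_add_cancel hij.le, he]
  intro i j he
  rcases lt_trichotomy i j with h | h | h
  · exact absurd he (key i j h)
  · exact h
  · exact absurd he.symm (key j i h)

theorem lt_iff_lt_of_card_eq {n : ℕ} {f g : Fin n → ℝ} {σ : Equiv.Perm (Fin n)} {c : ℝ}
    (hf : Monotone (f ∘ σ)) (hg : Monotone (g ∘ σ))
    (h : ({k | f k < c} : Finset _).card = ({k | g k < c} : Finset _).card) (k : Fin n) :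
    f k < c ↔ g k < c := by
  have key : ∀ f : Fin n → ℝ, Monotone (f ∘ σ) →
      ((σ.symm k : ℕ) < ({k | f k < c} : Finset _).card ↔ f k < c) := by
    intro f hf
    have := Tuple.lt_card_lt_iff_apply_lt_of_monotone (j := σ.symm k) (a := c) hf
    rw [Function.comp_apply, Equiv.apply_symm_apply] at this
    rw [← this, Finset.card_equiv σ.symm (t := {i | (f ∘ σ) i < c}) (by simp)]
  rw [← key f hf, ← key g hg, h]

theorem eEntropy_itinerary_le [Countable ι] [Countable κ] {μ : Measure ℝ}
    [IsProbabilityMeasure μ] {T : ℝ → ℝ} (hT : MeasurePreserving T μ μ) {X : ℝ → ι} {Z : ℝ → κ}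
    (hX : MeasurableFibers X) (hZ : MeasurableFibers Z) (C : Finset ℝ)
    (h : ∀ x y, (∀ c ∈ C, x < c ↔ y < c) → Z x = Z y → X x = X y) (n : ℕ) :
    eEntropy μ (itinerary T X n) ≤ eEntropy μ (ordPattern T n)
      + ENNReal.ofReal (C.card * log (n + 1)) + n * eEntropy μ Z := by
  let count : ℝ → C → Fin (n + 1) := fun ω c =>
    ⟨({k : Fin n | T^[(k : ℕ)] ω < c} : Finset _).card, Nat.lt_succ_of_le <|
      (Finset.card_le_univ _).trans (Fintype.card_fin n).le⟩
  have hO := measurableFibers_ordPattern hT.measurable n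
  have hI := measurableFibers_itinerary hT.measurable hZ n
  have hcount : MeasurableFibers count := by
    refine .pi fun c i => ?_
    let B : ℝ → Fin n → Bool := fun ω k => decide (T^[(k : ℕ)] ω < c)
    have hB : MeasurableFibers B := by
      refine .pi fun k => ?_
      have := measurableSet_lt (hT.measurable.iterate k) (measurable_const (a := (c : ℝ)))
      intro b
      cases b with
      | true =>
        convert this using 1
        ext ω
        simp
      | false =>
        convert this.compl using 1
        ext ω
        simp
    convert hB.preimage {b | ({k | b k = true} : Finset _).card = (i : ℕ)} using 1
    ext ω
    simp [B, Fin.ext_iff]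
  have hle := eEntropy_mono (μ := μ) ((hO.prodMk hcount).prodMk hI)
    (measurableFibers_itinerary hT.measurable hX n) (by
      intro ω ω' he
      simp only [Prod.mk.injEq] at he
      obtain ⟨⟨h₁, h₂⟩, h₃⟩ := he
      funext k
      refine h _ _ (fun c hc => ?_) (congrFun h₃ k)
      have hs : Monotone ((fun k : Fin n => T^[(k : ℕ)] ω') ∘ ordPattern T n ω) := by
        rw [h₁]
        exact Tuple.monotone_sort _
      exact lt_iff_lt_of_card_eq (Tuple.monotone_sort _) hs
        (congrArg Fin.val (congrFun h₂ ⟨c, hc⟩)) k)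
  refine hle.trans ((eEntropy_prodMk_le (hO.prodMk hcount) hI).trans
    (add_le_add ((eEntropy_prodMk_le hO hcount).trans (add_le_add le_rfl ?_))
      (eEntropy_itinerary_le_mul hT hZ n)))
  refine (eEntropy_le_log_card hcount Finset.univ (by simp)).trans (le_of_eq ?_)
  simp

theorem lt_iff_lt_of_itinerary_eq {Ω : Set ℝ} {T : ℝ → ℝ} (hmaps : Set.MapsTo T Ω Ω) {Q : ℝ → ι}
    (hsep : ∀ x ∈ Ω, ∀ y ∈ Ω, ∀ x' ∈ Ω, ∀ y' ∈ Ω, Q x = Q x' → Q y = Q y' → Q x ≠ Q y →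
      x < y → x' < y')
    (hmono : ∀ i, MonotoneOn T (Ω ∩ Q ⁻¹' {i}) ∨ AntitoneOn T (Ω ∩ Q ⁻¹' {i}))
    {ω ω' : ℝ} (hω : ω ∈ Ω) (hω' : ω' ∈ Ω)
    (hinj : Function.Injective fun k : ℕ => T^[k] ω)
    (hinj' : Function.Injective fun k : ℕ => T^[k] ω') {n : ℕ}
    (hQ : ∀ k ≤ n, Q (T^[k] ω) = Q (T^[k] ω'))
    (hlast : ∀ k < n, Q (T^[k] ω) = Q (T^[n] ω) →
      (T^[k] ω < T^[n] ω ↔ T^[k] ω' < T^[n] ω'))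
    {i j : ℕ} (hij : i < j) (hjn : j ≤ n) : T^[i] ω < T^[j] ω ↔ T^[i] ω' < T^[j] ω' := by
  have hΩ : ∀ k, T^[k] ω ∈ Ω := fun k => hmaps.iterate k hω
  have hΩ' : ∀ k, T^[k] ω' ∈ Ω := fun k => hmaps.iterate k hω'
  induction hd : n - j generalizing i j with
  | zero =>
    obtain rfl : j = n := by omega
    by_cases hne : Q (T^[i] ω) = Q (T^[j] ω)
    · exact hlast i hij hne
    have h₁ := hQ i (by omega)
    have h₂ := hQ j le_rfl
    exact ⟨hsep _ (hΩ _) _ (hΩ _) _ (hΩ' _) _ (hΩ' _) h₁ h₂ hne,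
      hsep _ (hΩ' _) _ (hΩ' _) _ (hΩ _) _ (hΩ _) h₁.symm h₂.symm (by rwa [← h₁, ← h₂])⟩
  | succ d ih =>
    have h₁ := hQ i (by omega)
    have h₂ := hQ j hjn
    by_cases hne : Q (T^[i] ω) = Q (T^[j] ω)
    swap
    · exact ⟨hsep _ (hΩ _) _ (hΩ _) _ (hΩ' _) _ (hΩ' _) h₁ h₂ hne,
        hsep _ (hΩ' _) _ (hΩ' _) _ (hΩ _) _ (hΩ _) h₁.symm h₂.symm (by rwa [← h₁, ← h₂])⟩
    have hnext := ih (i := i + 1) (j := j + 1) (by omega) (by omega) (by omega)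
    have hni : ∀ {x}, (Function.Injective fun k : ℕ => T^[k] x) →
        T^[i] x ≠ T^[j] x ∧ T^[i + 1] x ≠ T^[j + 1] x :=
      fun hx => ⟨fun h => hij.ne (hx h), fun h => hij.ne (Nat.succ_injective (hx h))⟩
    have aux : ∀ x, (∀ k, T^[k] x ∈ Ω) → (Function.Injective fun k : ℕ => T^[k] x) →
        Q (T^[i] x) = Q (T^[i] ω) → Q (T^[j] x) = Q (T^[i] ω) →
        (MonotoneOn T (Ω ∩ Q ⁻¹' {Q (T^[i] ω)}) →
          (T^[i] x < T^[j] x ↔ T^[i + 1] x < T^[j + 1] x)) ∧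
        (AntitoneOn T (Ω ∩ Q ⁻¹' {Q (T^[i] ω)}) →
          (T^[i] x < T^[j] x ↔ ¬ T^[i + 1] x < T^[j + 1] x)) := by
      intro x hxΩ hx hi hj
      have hi' : T^[i] x ∈ Ω ∩ Q ⁻¹' {Q (T^[i] ω)} := ⟨hxΩ i, hi⟩
      have hj' : T^[j] x ∈ Ω ∩ Q ⁻¹' {Q (T^[i] ω)} := ⟨hxΩ j, hj⟩
      obtain ⟨n₁, n₂⟩ := hni hx
      simp only [Function.iterate_succ_apply'] at n₂ ⊢
      refine ⟨fun hm => ⟨fun hl => (hm hi' hj' hl.le).lt_of_ne n₂, fun hl => ?_⟩,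
        fun hm => ⟨fun hl => (hm hi' hj' hl.le).not_gt, fun hl => ?_⟩⟩
      · exact lt_of_not_ge fun hle => (hm hj' hi' hle).not_gt hl
      · exact lt_of_not_ge fun hle => hl ((hm hj' hi' hle).lt_of_ne n₂)
    have a₁ := aux ω hΩ hinj rfl hne.symm
    have a₂ := aux ω' hΩ' hinj' h₁.symm (h₂.symm.trans hne.symm)
    rcases hmono (Q (T^[i] ω)) with hm | hm
    · rw [a₁.1 hm, a₂.1 hm]
      exact hnext
    · rw [a₁.2 hm, a₂.2 hm]
      exact not_congr hnext

theorem ordPattern_eq_of_lt_iff {T : ℝ → ℝ} {n : ℕ} {ω ω' : ℝ}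
    (hinj : Function.Injective fun k : ℕ => T^[k] ω)
    (hinj' : Function.Injective fun k : ℕ => T^[k] ω')
    (h : ∀ i j : ℕ, i < j → j < n → (T^[i] ω < T^[j] ω ↔ T^[i] ω' < T^[j] ω')) :
    ordPattern T n ω = ordPattern T n ω' := by
  have hle : ∀ i j : Fin n, T^[(i : ℕ)] ω ≤ T^[(j : ℕ)] ω → T^[(i : ℕ)] ω' ≤ T^[(j : ℕ)] ω' := by
    intro i j hle
    rcases lt_trichotomy (i : ℕ) j with hij | hij | hij
    · exact ((h i j hij j.2).1 (hle.lt_of_ne fun he => hij.ne (hinj he))).le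
    · rw [hij]
    · exact le_of_not_gt fun hlt => hle.not_gt ((h j i hij i.2).2 hlt) |>.elim
  rw [ordPattern, ordPattern, Tuple.eq_sort_iff]
  refine ⟨fun i j hij => hle _ _ (Tuple.monotone_sort (fun k : Fin n => T^[(k : ℕ)] ω) hij),
    fun i j hij he => ?_⟩
  exact absurd (Equiv.injective _ (Fin.val_injective (hinj' he))) hij.ne

end OrdinalPatterns

section Recurrence

open scoped ENNReal

variable {ι : Type*}

theorem card_filter_range_mul_le (p : ℕ → Prop) [DecidablePred p] (N b : ℕ) (c : ℕ → ℝ≥0∞)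
    (h : ∀ t, (({i ∈ Finset.range N | p (t * N + i)}.card : ℕ) : ℝ≥0∞) ≤ c t) :
    (({k ∈ Finset.range (b * N) | p k}.card : ℕ) : ℝ≥0∞) ≤ ∑ t ∈ Finset.range b, c t := by
  induction b with
  | zero => simp
  | succ b ih =>
    have : {k ∈ Finset.range ((b + 1) * N) | p k}.card
        = {k ∈ Finset.range (b * N) | p k}.card
          + {i ∈ Finset.range N | p (b * N + i)}.card := by
      simp only [Finset.card_filter, Nat.succ_mul, Finset.sum_range_add]
    rw [this, Finset.sum_range_succ, Nat.cast_add]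
    exact add_le_add ih (h b)

/-- The points returning to their own class of `Q` within the first `N` steps of their orbit. -/
def returnSet (T : ℝ → ℝ) (Q : ℝ → ι) (N : ℕ) : Set ℝ :=
  {ω | ∃ i j, i < j ∧ j < N ∧ Q (T^[i] ω) = Q (T^[j] ω)}

theorem measurableSet_returnSet [Countable ι] {T : ℝ → ℝ} (hT : Measurable T) {Q : ℝ → ι}
    (hQ : MeasurableFibers Q) (N : ℕ) : MeasurableSet (returnSet T Q N) := by
  have : returnSet T Q N = ⋃ i, ⋃ j, ⋃ (_ : i < j ∧ j < N),
      (fun ω => (Q (T^[i] ω), Q (T^[j] ω))) ⁻¹' {x | x.1 = x.2} := by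
    ext ω
    simp [returnSet, and_assoc]
  rw [this]
  exact .iUnion fun i => .iUnion fun j => .iUnion fun _ =>
    ((hQ.comp (hT.iterate i)).prodMk (hQ.comp (hT.iterate j))).preimage _

open Classical in
theorem lintegral_card_visits_le [Countable ι] {μ : Measure ℝ} [IsProbabilityMeasure μ]
    {T : ℝ → ℝ} (hT : MeasurePreserving T μ μ) {Q : ℝ → ι} (hQ : MeasurableFibers Q)
    {N n b : ℕ} (hn : n ≤ b * N) (q : ℝ → ι) :
    ∫⁻ ω, (({k ∈ Finset.range n | Q (T^[k] ω) = q ω}.card : ℕ) : ℝ≥0∞) ∂μ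
      ≤ b * (1 + N * μ (returnSet T Q N)) := by
  have hB := measurableSet_returnSet hT.measurable hQ N
  set B := returnSet T Q N
  have hpt : ∀ ω, (({k ∈ Finset.range n | Q (T^[k] ω) = q ω}.card : ℕ) : ℝ≥0∞)
      ≤ ∑ t ∈ Finset.range b, (1 + (N : ℝ≥0∞) * B.indicator 1 (T^[t * N] ω)) := by
    intro ω
    refine le_trans ?_ (card_filter_range_mul_le (fun k => Q (T^[k] ω) = q ω) N b _ ?_)
    · exact_mod_cast Finset.card_le_card
        (Finset.filter_subset_filter _ (Finset.range_subset_range.2 hn))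
    intro t
    by_cases hω : T^[t * N] ω ∈ B
    · rw [Set.indicator_of_mem hω, Pi.one_apply, mul_one]
      refine le_add_left ?_
      exact_mod_cast (Finset.card_filter_le _ _).trans (Finset.card_range N).le
    · rw [Set.indicator_of_notMem hω, mul_zero, add_zero]
      rw [← Nat.cast_one, Nat.cast_le, Finset.card_le_one]
      intro i hi j hj
      simp only [Finset.mem_filter, Finset.mem_range] at hi hj
      have hit : ∀ i, T^[t * N + i] ω = T^[i] (T^[t * N] ω) := fun i => by
        rw [add_comm, Function.iterate_add_apply]
      rw [hit] at hi hj
      by_contra hne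
      rcases lt_or_gt_of_ne hne with h | h
      · exact hω ⟨i, j, h, hj.1, hi.2.trans hj.2.symm⟩
      · exact hω ⟨j, i, h, hi.1, hj.2.trans hi.2.symm⟩
  refine (lintegral_mono hpt).trans ?_
  have hm : ∀ t, Measurable fun ω => (N : ℝ≥0∞) * B.indicator 1 (T^[t * N] ω) := fun t =>
    ((measurable_one.indicator hB).comp (hT.measurable.iterate _)).const_mul _
  rw [lintegral_finsetSum _ fun t _ => (hm t).const_add 1]
  have : ∀ t, ∫⁻ ω, (1 + (N : ℝ≥0∞) * B.indicator 1 (T^[t * N] ω)) ∂μ = 1 + N * μ B := by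
    intro t
    rw [lintegral_add_left measurable_const, lintegral_const_mul' _ _ (ENNReal.natCast_ne_top N),
      (hT.iterate (t * N)).lintegral_comp (measurable_one.indicator hB),
      lintegral_indicator_one hB]
    simp
  simp [this, mul_add]

theorem eEntropy_ordPattern_le [Countable ι] {μ : Measure ℝ} [IsProbabilityMeasure μ]
    {Ω : Set ℝ} (hΩ : ∀ᵐ ω ∂μ, ω ∈ Ω) {T : ℝ → ℝ} (hT : MeasurePreserving T μ μ)
    (hmaps : Set.MapsTo T Ω Ω) (hap : Aperiodic μ T) {Q : ℝ → ι} (hQ : MeasurableFibers Q)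
    (hsep : ∀ x ∈ Ω, ∀ y ∈ Ω, ∀ x' ∈ Ω, ∀ y' ∈ Ω, Q x = Q x' → Q y = Q y' → Q x ≠ Q y →
      x < y → x' < y')
    (hmono : ∀ i, MonotoneOn T (Ω ∩ Q ⁻¹' {i}) ∨ AntitoneOn T (Ω ∩ Q ⁻¹' {i}))
    {N n b : ℕ} (hn : n ≤ b * N) :
    eEntropy μ (ordPattern T (n + 1)) ≤ eEntropy μ (itinerary T Q (n + 1))
      + ENNReal.ofReal (log 2) * (b * (1 + N * μ (returnSet T Q N))) := by
  classical
  let G : Set ℝ := {ω | ω ∈ Ω ∧ Function.Injective fun k : ℕ => T^[k] ω}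
  have hG : ∀ᵐ ω ∂μ, ω ∈ G := hΩ.and (hap.ae_injective hT)
  let F : (Fin (n + 1) → ι) → Finset (Equiv.Perm (Fin (n + 1))) := fun a =>
    {σ | ∃ ω ∈ G, itinerary T Q (n + 1) ω = a ∧ ordPattern T (n + 1) ω = σ}
  let S : (Fin (n + 1) → ι) → Finset (Fin n) := fun a => {k | a k.castSucc = a (Fin.last n)}
  have hFS : ∀ a, (F a).card ≤ 2 ^ (S a).card := by
    intro a
    have hex : ∀ σ : Equiv.Perm (Fin (n + 1)), ∃ ω, σ ∈ F a →
        ω ∈ G ∧ itinerary T Q (n + 1) ω = a ∧ ordPattern T (n + 1) ω = σ := by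
      intro σ
      by_cases hσ : σ ∈ F a
      · obtain ⟨ω, hω⟩ := (Finset.mem_filter.1 hσ).2
        exact ⟨ω, fun _ => hω⟩
      · exact ⟨0, fun h => absurd h hσ⟩
    choose w hw using hex
    rw [← Finset.card_powerset]
    refine Finset.card_le_card_of_injOn
      (fun σ => {k ∈ S a | T^[(k : ℕ)] (w σ) < T^[n] (w σ)})
      (fun σ _ => Finset.mem_powerset.2 (Finset.filter_subset _ _)) ?_
    intro σ hσ τ hτ he
    obtain ⟨⟨hσΩ, hσi⟩, hσa, hσo⟩ := hw σ hσ
    obtain ⟨⟨hτΩ, hτi⟩, hτa, hτo⟩ := hw τ hτ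
    rw [← hσo, ← hτo]
    have hval : ∀ k ≤ n, Q (T^[k] (w σ)) = Q (T^[k] (w τ)) := fun k hk =>
      congrFun (hσa.trans hτa.symm) ⟨k, Nat.lt_succ_of_le hk⟩
    refine ordPattern_eq_of_lt_iff hσi hτi fun i j hij hj =>
      lt_iff_lt_of_itinerary_eq hmaps hsep hmono hσΩ hτΩ hσi hτi hval ?_ hij
        (Nat.le_of_lt_succ hj)
    intro k hk hkn
    have hkS : (⟨k, hk⟩ : Fin n) ∈ S a := by
      simp only [S, Finset.mem_filter, Finset.mem_univ, true_and]
      rw [← hσa]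
      exact hkn
    have := Finset.ext_iff.1 he ⟨k, hk⟩
    simpa [hkS] using this
  have hle := eEntropy_le_add_lintegral (μ := μ) (measurableFibers_itinerary hT.measurable hQ _)
    (measurableFibers_ordPattern hT.measurable _) F (by
      filter_upwards [hG] with ω hω
      exact Finset.mem_filter.2 ⟨Finset.mem_univ _, ω, hω, rfl, rfl⟩)
  refine hle.trans (add_le_add le_rfl ?_)
  refine le_trans ?_ (mul_le_mul_right (lintegral_card_visits_le hT hQ hn
    fun ω => Q (T^[n] ω)) _)
  rw [← lintegral_const_mul' _ _ ENNReal.ofReal_ne_top]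
  refine lintegral_mono fun ω => ?_
  have hS : (S (itinerary T Q (n + 1) ω)).card
      = {k ∈ Finset.range n | Q (T^[k] ω) = Q (T^[n] ω)}.card := by
    rw [Finset.card_filter, Finset.card_filter, ← Fin.sum_univ_eq_sum_range
      (fun k => if Q (T^[k] ω) = Q (T^[n] ω) then 1 else 0)]
    rfl
  rw [← hS, ← ENNReal.ofReal_natCast, ← ENNReal.ofReal_mul (log_nonneg one_le_two)]
  refine ENNReal.ofReal_le_ofReal ?_
  rcases Nat.eq_zero_or_pos (F (itinerary T Q (n + 1) ω)).card with h0 | h0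
  · rw [h0]
    simpa using mul_nonneg (log_nonneg one_le_two) (Nat.cast_nonneg _)
  rw [mul_comm, ← log_pow]
  exact log_le_log (by exact_mod_cast h0) (by exact_mod_cast hFS _)

end Recurrence

section Approximation

open scoped ENNReal

/-- A measurable set is approximated by sets which are unions of finitely many intervals. -/
theorem exists_finite_cuts_symmDiff_lt (μ : Measure ℝ) [IsFiniteMeasure μ] {A : Set ℝ}
    (hA : MeasurableSet A) {ε : ℝ≥0∞} (hε : 0 < ε) :
    ∃ (C : Finset ℝ) (B : Set ℝ), MeasurableSet B ∧
      (∀ x y, (∀ c ∈ C, x < c ↔ y < c) → (x ∈ B ↔ y ∈ B)) ∧ μ (B ∆ A) < ε := by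
  classical
  let R : Set (Set ℝ) := {B | MeasurableSet B ∧ ∃ C : Finset ℝ,
    ∀ x y, (∀ c ∈ C, x < c ↔ y < c) → (x ∈ B ↔ y ∈ B)}
  have hR : IsSetRing R := by
    refine ⟨⟨.empty, ∅, by simp⟩, ?_, ?_⟩
    · rintro s t ⟨hs, C, hC⟩ ⟨ht, D, hD⟩
      refine ⟨hs.union ht, C ∪ D, fun x y h => ?_⟩
      rw [Set.mem_union, Set.mem_union, hC x y fun c hc => h c (Finset.mem_union_left _ hc),
        hD x y fun c hc => h c (Finset.mem_union_right _ hc)]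
    · rintro s t ⟨hs, C, hC⟩ ⟨ht, D, hD⟩
      refine ⟨hs.diff ht, C ∪ D, fun x y h => ?_⟩
      rw [Set.mem_sdiff, Set.mem_sdiff, hC x y fun c hc => h c (Finset.mem_union_left _ hc),
        hD x y fun c hc => h c (Finset.mem_union_right _ hc)]
  have hgen : (inferInstance : MeasurableSpace ℝ) = MeasurableSpace.generateFrom R := by
    refine le_antisymm ?_ (MeasurableSpace.generateFrom_le fun s hs => hs.1)
    rw [BorelSpace.measurable_eq (α := ℝ), borel_eq_generateFrom_Iio]
    refine MeasurableSpace.generateFrom_mono ?_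
    rintro _ ⟨c, rfl⟩
    exact ⟨measurableSet_Iio, {c}, fun x y h => h c (Finset.mem_singleton_self c)⟩
  obtain ⟨B, ⟨hB, C, hC⟩, hlt⟩ := exists_measure_symmDiff_lt_of_generateFrom_isSetRing (μ := μ) hR
    ⟨{Set.univ}, Set.countable_singleton _,
      Set.singleton_subset_iff.2 ⟨.univ, ∅, by simp⟩, by simp⟩ hgen hA hε
  exact ⟨C, B, hB, hC, hlt⟩

theorem measurableFibers_decide_mem {α : Type*} [MeasurableSpace α] {D : Set α}
    [DecidablePred (· ∈ D)] (hD : MeasurableSet D) : MeasurableFibers fun ω => decide (ω ∈ D) := by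
  intro b
  cases b with
  | true =>
    convert hD using 1
    ext ω
    simp
  | false =>
    convert hD.compl using 1
    ext ω
    simp

open Classical in
theorem exists_eEntropy_decide_mem_le {α : Type*} [MeasurableSpace α] (μ : Measure α)
    [IsProbabilityMeasure μ] {ε : ℝ≥0∞} (hε : 0 < ε) :
    ∃ δ > 0, ∀ D : Set α, MeasurableSet D → μ D < δ →
      eEntropy μ (fun ω => decide (ω ∈ D)) ≤ ε := by
  have hcont : Continuous fun x : ℝ =>
      ENNReal.ofReal (negMulLog x) + ENNReal.ofReal (negMulLog (1 - x)) :=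
    (ENNReal.continuous_ofReal.comp continuous_negMulLog).add
      (ENNReal.continuous_ofReal.comp
        (continuous_negMulLog.comp (continuous_const.sub continuous_id)))
  have h0 : Tendsto (fun x : ℝ≥0∞ => ENNReal.ofReal (negMulLog x.toReal)
      + ENNReal.ofReal (negMulLog (1 - x.toReal))) (nhds 0) (nhds 0) := by
    have := (hcont.tendsto 0).comp (ENNReal.tendsto_toReal ENNReal.zero_ne_top)
    simpa [Function.comp_def] using this
  obtain ⟨δ, hδ, h⟩ := ENNReal.nhds_zero_basis.eventually_iff.1 (h0.eventually_le_const hε)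
  refine ⟨δ, hδ, fun D hD hlt => le_trans (le_of_eq ?_) (h hlt)⟩
  have h₁ : (fun ω => decide (ω ∈ D)) ⁻¹' {true} = D := by
    ext ω
    simp
  have h₂ : (fun ω => decide (ω ∈ D)) ⁻¹' {false} = Dᶜ := by
    ext ω
    simp
  rw [eEntropy, tsum_fintype, Fintype.sum_bool, h₁, h₂, probReal_compl_eq_one_sub hD,
    measureReal_def]

theorem exists_eEntropy_sub_le {α : Type*} [MeasurableSpace α] (μ : Measure α)
    [IsProbabilityMeasure μ] {X : α → ℕ} (hfin : eEntropy μ X ≠ ∞)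
    {ε : ℝ≥0∞} (hε : 0 < ε) : ∃ N, eEntropy μ (fun ω => X ω + 1 - N) ≤ ε := by
  have hR : ∀ N, eEntropy μ (fun ω => X ω + 1 - N)
      = ENNReal.ofReal (negMulLog (μ.real (X ⁻¹' {i | i < N})))
        + ∑' k, ENNReal.ofReal (negMulLog (μ.real (X ⁻¹' {k + N}))) := by
    intro N
    rw [eEntropy, tsum_eq_zero_add' ENNReal.summable]
    congr 4
    · ext ω
      simp only [Set.mem_preimage, Set.mem_singleton_iff, Set.mem_ofPred_eq]
      omega
    · funext k
      congr 3
      ext ω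
      simp only [Set.mem_preimage, Set.mem_singleton_iff]
      omega
  have h₁ := ENNReal.tendsto_sum_nat_add _ hfin
  have h₂ : Tendsto (fun N : ℕ => ENNReal.ofReal (negMulLog (μ.real (X ⁻¹' {i | i < N}))))
      atTop (nhds 0) := by
    have hU : ⋃ N : ℕ, X ⁻¹' {i | i < N} = Set.univ :=
      Set.eq_univ_of_forall fun ω => Set.mem_iUnion.2 ⟨X ω + 1, Nat.lt_succ_self _⟩
    have hmono : Monotone fun N : ℕ => X ⁻¹' {i | i < N} :=
      fun a b hab ω hω => lt_of_lt_of_le hω hab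
    have ht := tendsto_measure_iUnion_atTop (μ := μ) hmono
    rw [hU, measure_univ] at ht
    have ht' := (ENNReal.tendsto_toReal ENNReal.one_ne_top).comp ht
    have := ((ENNReal.continuous_ofReal.comp continuous_negMulLog).tendsto 1).comp ht'
    simpa [Function.comp_def, measureReal_def] using this
  have h := h₂.add h₁
  rw [add_zero] at h
  obtain ⟨N, hN⟩ := (h.eventually_le_const hε).exists
  exact ⟨N, by rw [hR]; exact hN⟩

/-- Up to a function `Z` of small entropy, a function of finite entropy is determined by the
position relative to finitely many points. -/
theorem exists_finite_cuts_eEntropy_le (μ : Measure ℝ) [IsProbabilityMeasure μ] {X : ℝ → ℕ}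
    (hX : MeasurableFibers X) (hfin : eEntropy μ X ≠ ∞) {ε : ℝ≥0∞} (hε : 0 < ε) :
    ∃ (N : ℕ) (Z : ℝ → (Fin N → Bool) × ℕ) (C : Finset ℝ), MeasurableFibers Z ∧
      eEntropy μ Z ≤ ε ∧
      ∀ x y, (∀ c ∈ C, x < c ↔ y < c) → Z x = Z y → X x = X y := by
  classical
  have hε2 : 0 < ε / 2 := ENNReal.half_pos hε.ne'
  obtain ⟨N, hN⟩ := exists_eEntropy_sub_le μ hfin hε2
  have hεN : 0 < ε / 2 / N := ENNReal.div_pos hε2.ne' (ENNReal.natCast_ne_top N)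
  obtain ⟨δ, hδ, hD⟩ := exists_eEntropy_decide_mem_le μ hεN
  choose C B hBm hBC hBδ using fun i : Fin N =>
    exists_finite_cuts_symmDiff_lt μ (hX (i : ℕ)) hδ
  have hDm : ∀ i, MeasurableSet (B i ∆ (X ⁻¹' {(i : ℕ)})) := fun i => (hBm i).symmDiff (hX _)
  have hE := MeasurableFibers.pi fun i => measurableFibers_decide_mem (hDm i)
  have hR : MeasurableFibers fun ω => X ω + 1 - N := fun k => by
    exact hX.preimage {i | i + 1 - N = k}
  refine ⟨N, fun ω => (fun i => decide (ω ∈ B i ∆ (X ⁻¹' {(i : ℕ)})), X ω + 1 - N),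
    Finset.univ.biUnion C, hE.prodMk hR, ?_, ?_⟩
  · refine (eEntropy_prodMk_le hE hR).trans ?_
    rw [← ENNReal.add_halves ε]
    refine add_le_add ((eEntropy_pi_le fun i => measurableFibers_decide_mem (hDm i)).trans ?_) hN
    refine (Finset.sum_le_sum fun i _ => hD _ (hDm i) (hBδ i)).trans ?_
    simpa using ENNReal.mul_div_le
  · intro x y hC h
    simp only [Prod.mk.injEq] at h
    obtain ⟨h₁, h₂⟩ := h
    by_cases hx : X x < N
    · have hB := hBC ⟨X x, hx⟩ x y fun c hc =>
        hC c (Finset.mem_biUnion.2 ⟨_, Finset.mem_univ _, hc⟩)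
      have he := congrFun h₁ ⟨X x, hx⟩
      simp only [Set.mem_symmDiff, Set.mem_preimage, Set.mem_singleton_iff,
        decide_eq_decide] at he
      by_contra hne
      have hne' := Ne.symm hne
      by_cases hxB : x ∈ B ⟨X x, hx⟩ <;> simp_all
    · omega

end Approximation

section Partitions

open scoped ENNReal

/-- The index of the member of the partition `P` containing `ω`. -/
noncomputable def label (P : ℕ → Set ℝ) (ω : ℝ) : ℕ :=
  sInf {i | ω ∈ P i}

variable {Ω : Set ℝ} {P : ℕ → Set ℝ}

theorem IsPartitionOf.label_eq (hP : IsPartitionOf Ω P) {ω : ℝ} {i : ℕ} (h : ω ∈ P i) :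
    label P ω = i := by
  have hmem : ω ∈ P (label P ω) := Nat.sInf_mem (s := {i | ω ∈ P i}) ⟨i, h⟩
  by_contra hne
  exact Set.disjoint_left.1 (hP.1 hne) hmem h

theorem IsPartitionOf.mem_iff_label_eq (hP : IsPartitionOf Ω P) {ω : ℝ} (hω : ω ∈ Ω) (i : ℕ) :
    ω ∈ P i ↔ label P ω = i := by
  refine ⟨hP.label_eq, ?_⟩
  rintro rfl
  rw [← hP.2] at hω
  obtain ⟨j, hj⟩ := Set.mem_iUnion.1 hω
  rwa [hP.label_eq hj]

theorem IsPartitionOf.measurableFibers_label (hP : IsPartitionOf Ω P)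
    (hm : ∀ i, MeasurableSet (P i)) : MeasurableFibers (label P) := by
  have hΩ : MeasurableSet Ω := hP.2 ▸ MeasurableSet.iUnion hm
  intro i
  have : label P ⁻¹' {i} = P i ∪ (Ωᶜ ∩ {_ω | i = 0}) := by
    ext ω
    by_cases hω : ω ∈ Ω
    · simp [hω, hP.mem_iff_label_eq hω i]
    · have hall : ∀ j, ω ∉ P j := fun j hj => hω (hP.2 ▸ Set.mem_iUnion.2 ⟨j, hj⟩)
      have h0 : label P ω = 0 := by simp [label, hall]
      simp [hω, hall, h0, eq_comm]
  rw [this]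
  exact (hm i).union (hΩ.compl.inter (.const _))

theorem IsIntervalIn.measurableSet {A : Set ℝ} (hA : IsIntervalIn Ω A) (hΩ : MeasurableSet Ω) :
    MeasurableSet A := by
  have : A = Ω ∩ {y | ∃ x ∈ A, ∃ z ∈ A, x ≤ y ∧ y ≤ z} := by
    ext y
    refine ⟨fun h => ⟨hA.1 h, y, h, y, h, le_rfl, le_rfl⟩, ?_⟩
    rintro ⟨hy, x, hx, z, hz, hxy, hyz⟩
    exact hA.2 x hx z hz y hy hxy hyz
  rw [this]
  refine hΩ.inter (Set.OrdConnected.measurableSet ⟨?_⟩)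
  rintro a ⟨x, hx, -, -, hxa, -⟩ b ⟨-, -, z, hz, -, hbz⟩ y hy
  exact ⟨x, hx, z, hz, hxa.trans hy.1, hy.2.trans hbz⟩

theorem IsIntervalIn.lt_of_lt {A B : Set ℝ} (hA : IsIntervalIn Ω A) (hB : IsIntervalIn Ω B)
    (hAB : Disjoint A B) {x y x' y' : ℝ} (hx : x ∈ A) (hx' : x' ∈ A) (hy : y ∈ B) (hy' : y' ∈ B)
    (h : x < y) : x' < y' := by
  have hd := Set.disjoint_left.1 hAB
  by_contra! hle
  rcases le_total x y' with h₁ | h₁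
  · exact hd (hA.2 x hx x' hx' y' (hB.1 hy') h₁ hle) hy'
  · exact hd hx (hB.2 y' hy' y hy x (hA.1 hx) h₁ h.le)

variable {μ : Measure ℝ} [IsProbabilityMeasure μ] {T : ℝ → ℝ}

theorem shEntropy_multiCell (hΩ : ∀ᵐ ω ∂μ, ω ∈ Ω) (hmaps : Set.MapsTo T Ω Ω) {X : ℝ → ℕ}
    (h : ∀ ω ∈ Ω, ∀ i, ω ∈ P i ↔ X ω = i) (n : ℕ) :
    shEntropy μ (multiCell T P n) = (eEntropy μ (itinerary T X n)).toReal := by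
  refine shEntropy_eq_toReal_eEntropy fun a => measure_congr ?_
  filter_upwards [hΩ] with ω hω
  refine propext ?_
  change ω ∈ multiCell T P n a ↔ itinerary T X n ω = a
  simp only [multiCell, itinerary, Set.mem_iInter, Set.mem_preimage, funext_iff]
  exact forall_congr' fun k => h _ (hmaps.iterate k hω) _

theorem shEntropy_ordCell (hΩ : ∀ᵐ ω ∂μ, ω ∈ Ω) (hT : MeasurePreserving T μ μ)
    (hap : Aperiodic μ T) (n : ℕ) :
    shEntropy μ (ordCell Ω T n) = (eEntropy μ (ordPattern T n)).toReal := by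
  refine shEntropy_eq_toReal_eEntropy fun σ => measure_congr ?_
  filter_upwards [hΩ, hap.ae_injective hT] with ω hω hinj
  refine propext ?_
  change ω ∈ ordCell Ω T n σ ↔ ordPattern T n ω = σ
  rw [eq_comm, ordPattern, Tuple.eq_sort_iff]
  refine ⟨fun h => ⟨fun i j hij => h.2 i j hij, fun i j hij he => ?_⟩, fun h => ⟨hω, h.1⟩⟩
  exact absurd (Equiv.injective _ (Fin.val_injective (hinj he))) hij.ne

theorem eEntropy_ordPattern_ne_top (hT : Measurable T) (n : ℕ) :
    eEntropy μ (ordPattern T n) ≠ ∞ :=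
  ((eEntropy_le_log_card (measurableFibers_ordPattern hT n) Finset.univ (by simp)).trans_lt
    ENNReal.ofReal_lt_top).ne

theorem toReal_eEntropy_itinerary_div_le (hT : MeasurePreserving T μ μ) {X : ℝ → ℕ}
    (hX : MeasurableFibers X) (hfin : eEntropy μ X ≠ ∞) (n : ℕ) :
    (eEntropy μ (itinerary T X n)).toReal / n ≤ (eEntropy μ X).toReal := by
  refine div_le_of_le_mul₀ (Nat.cast_nonneg _) ENNReal.toReal_nonneg ?_
  have := ENNReal.toReal_mono (ENNReal.mul_ne_top (ENNReal.natCast_ne_top n) hfin)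
    (eEntropy_itinerary_le_mul hT hX n)
  rwa [ENNReal.toReal_mul, ENNReal.toReal_natCast, mul_comm] at this

theorem eEntropy_itinerary_ne_top (hT : MeasurePreserving T μ μ) {X : ℝ → ℕ}
    (hX : MeasurableFibers X) (hfin : eEntropy μ X ≠ ∞) (n : ℕ) :
    eEntropy μ (itinerary T X n) ≠ ∞ :=
  ((eEntropy_itinerary_le_mul hT hX n).trans_lt
    (ENNReal.mul_lt_top (ENNReal.natCast_lt_top n) hfin.lt_top)).ne

theorem liminf_le_liminf_add {u v : ℕ → ℝ} {ε K : ℝ} (hv : ∀ n, 0 ≤ v n)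
    (hu : ∀ᶠ n in atTop, u n ≤ K)
    (h : ∀ᶠ n in atTop, v n ≤ u n + ε) : liminf v atTop ≤ liminf u atTop + ε := by
  rw [← sub_le_iff_le_add]
  refine le_of_forall_lt fun b hb => ?_
  obtain ⟨c, hbc, hc⟩ := exists_between hb
  refine hbc.trans_le (le_liminf_of_le
    (isBoundedUnder_of_eventually_le hu).isCoboundedUnder_ge ?_)
  have := eventually_lt_of_lt_liminf (lt_sub_iff_add_lt.1 hc)
    (isBoundedUnder_of_eventually_ge (.of_forall hv))
  filter_upwards [this, h] with n h₁ h₂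
  linarith

theorem eventually_itinerary_le_ordPattern (hT : MeasurePreserving T μ μ) {X : ℝ → ℕ}
    (hX : MeasurableFibers X) (hfin : eEntropy μ X ≠ ∞) {ε : ℝ} (hε : 0 < ε) :
    ∀ᶠ n : ℕ in atTop, (eEntropy μ (itinerary T X n)).toReal / n
      ≤ (eEntropy μ (ordPattern T n)).toReal / n + ε := by
  obtain ⟨N, Z, C, hZ, hZε, hC⟩ := exists_finite_cuts_eEntropy_le μ hX hfin
    (ENNReal.ofReal_pos.2 (half_pos hε))
  have hZfin : eEntropy μ Z ≠ ∞ := ne_top_of_le_ne_top ENNReal.ofReal_ne_top hZε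
  have hlim : Tendsto (fun n : ℕ => C.card * (log (n + 1 : ℝ) / n)) atTop (nhds 0) := by
    have h₁ : Tendsto (fun n : ℕ => log (n + 1 : ℝ) / (n + 1)) atTop (nhds 0) := by
      have := (isLittleO_log_id_atTop.tendsto_div_nhds_zero).comp
        (tendsto_natCast_atTop_atTop.comp (tendsto_add_atTop_nat 1))
      simpa [Function.comp_def] using this
    have h₂ : Tendsto (fun n : ℕ => 1 + 1 / (n : ℝ)) atTop (nhds 1) := by
      simpa using tendsto_one_div_atTop_nhds_zero_nat.const_add (1 : ℝ)
    have h₃ := (h₁.mul h₂).const_mul (C.card : ℝ)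
    rw [zero_mul, mul_zero] at h₃
    refine h₃.congr' ?_
    filter_upwards [eventually_gt_atTop 0] with n hn
    have : (0 : ℝ) < n := Nat.cast_pos.2 hn
    field_simp
  filter_upwards [hlim.eventually_le_const (half_pos hε), eventually_gt_atTop 0] with n hn hn0
  have hn0 : (0 : ℝ) < n := Nat.cast_pos.2 hn0
  have hOfin := eEntropy_ordPattern_ne_top (μ := μ) hT.measurable n
  have hle := eEntropy_itinerary_le hT hX hZ C hC n
  have hnZ : n * eEntropy μ Z ≠ ∞ := ENNReal.mul_ne_top (ENNReal.natCast_ne_top n) hZfin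
  have hle' := ENNReal.toReal_mono (ENNReal.add_ne_top.2
    ⟨ENNReal.add_ne_top.2 ⟨hOfin, ENNReal.ofReal_ne_top⟩, hnZ⟩) hle
  have hlog : 0 ≤ log (n + 1 : ℝ) := log_nonneg (by linarith)
  rw [ENNReal.toReal_add (ENNReal.add_ne_top.2 ⟨hOfin, ENNReal.ofReal_ne_top⟩) hnZ,
    ENNReal.toReal_add hOfin ENNReal.ofReal_ne_top, ENNReal.toReal_mul, ENNReal.toReal_natCast,
    ENNReal.toReal_ofReal (by positivity)] at hle'
  have hZr : (eEntropy μ Z).toReal ≤ ε / 2 := ENNReal.toReal_le_of_le_ofReal (by linarith) hZε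
  rw [← mul_div_assoc, div_le_iff₀ hn0] at hn
  rw [div_add' _ _ _ hn0.ne']
  refine div_le_div_of_nonneg_right ?_ hn0.le
  nlinarith

/-- The partition function of `M`, refined by a partition into intervals of length `1 / m`. -/
noncomputable def refinedLabel (M : ℕ → Set ℝ) (m : ℕ) (ω : ℝ) : ℕ :=
  Encodable.encode (label M ω, ⌊(m : ℝ) * ω⌋)

theorem refinedLabel_eq_iff {M : ℕ → Set ℝ} {m : ℕ} {x y : ℝ} :
    refinedLabel M m x = refinedLabel M m y ↔
      label M x = label M y ∧ ⌊(m : ℝ) * x⌋ = ⌊(m : ℝ) * y⌋ := by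
  rw [refinedLabel, refinedLabel, Encodable.encode_inj, Prod.mk.injEq]

theorem measurableFibers_floor (m : ℕ) : MeasurableFibers fun ω : ℝ => ⌊(m : ℝ) * ω⌋ :=
  fun i => (Int.measurable_floor.comp (measurable_const_mul (m : ℝ))) (measurableSet_singleton i)

theorem measurableFibers_refinedLabel {M : ℕ → Set ℝ} (hM : MeasurableFibers (label M)) (m : ℕ) :
    MeasurableFibers (refinedLabel M m) := by
  intro k
  exact (hM.prodMk (measurableFibers_floor m)).preimage {x | Encodable.encode x = k}

theorem eEntropy_refinedLabel_ne_top (hΩc : IsCompact Ω) (hΩ : ∀ᵐ ω ∂μ, ω ∈ Ω) {M : ℕ → Set ℝ}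
    (hM : MeasurableFibers (label M)) (hfin : eEntropy μ (label M) ≠ ∞) (m : ℕ) :
    eEntropy μ (refinedLabel M m) ≠ ∞ := by
  have hF := measurableFibers_floor m
  have h₁ : eEntropy μ (refinedLabel M m)
      ≤ eEntropy μ fun ω => (label M ω, ⌊(m : ℝ) * ω⌋) :=
    eEntropy_mono (hM.prodMk hF) (measurableFibers_refinedLabel hM m) fun ω ω' h => by
      rw [refinedLabel, h, refinedLabel]
  obtain ⟨a, ha⟩ := hΩc.bddBelow
  obtain ⟨b, hb⟩ := hΩc.bddAbove
  have h₂ := eEntropy_le_log_card (μ := μ) hF (Finset.Icc ⌊(m : ℝ) * a⌋ ⌊(m : ℝ) * b⌋) (by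
    filter_upwards [hΩ] with ω hω
    have := ha hω
    have := hb hω
    exact Finset.mem_Icc.2 ⟨Int.floor_mono (by gcongr), Int.floor_mono (by gcongr)⟩)
  exact ((h₁.trans ((eEntropy_prodMk_le hM hF).trans (add_le_add le_rfl h₂))).trans_lt
    (ENNReal.add_lt_top.2 ⟨hfin.lt_top, ENNReal.ofReal_lt_top⟩)).ne

theorem tendsto_measure_returnSet_refinedLabel (hT : MeasurePreserving T μ μ)
    (hap : Aperiodic μ T) {M : ℕ → Set ℝ} (hM : MeasurableFibers (label M)) (N : ℕ) :
    Tendsto (fun m => μ (returnSet T (refinedLabel M m) N)) atTop (nhds 0) := by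
  have h := tendsto_measure_of_ae_tendsto_indicator_of_isFiniteMeasure (μ := μ) atTop
    (A := ∅) .empty (As := fun m => returnSet T (refinedLabel M m) N)
    (fun m => measurableSet_returnSet hT.measurable (measurableFibers_refinedLabel hM m) N) (by
      filter_upwards [hap.ae_injective hT] with ω hω
      have key : ∀ᶠ m : ℕ in atTop, ∀ i ∈ Finset.range N, ∀ j ∈ Finset.range N, i < j →
          ⌊(m : ℝ) * T^[i] ω⌋ ≠ ⌊(m : ℝ) * T^[j] ω⌋ := by
        rw [eventually_all_finset]
        intro i _
        rw [eventually_all_finset]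
        intro j _
        by_cases hij : i < j
        swap
        · exact .of_forall fun m h => absurd h hij
        have hpos : 0 < |T^[i] ω - T^[j] ω| :=
          abs_pos.2 (sub_ne_zero.2 fun he => hij.ne (hω he))
        have ht : Tendsto (fun m : ℕ => (m : ℝ) * |T^[i] ω - T^[j] ω|) atTop atTop :=
          tendsto_natCast_atTop_atTop.atTop_mul_const hpos
        filter_upwards [ht.eventually_ge_atTop 1] with m hm _ he
        have := Int.abs_sub_lt_one_of_floor_eq_floor he
        rw [← mul_sub, abs_mul, Nat.abs_cast] at this
        exact this.not_ge hm
      filter_upwards [key] with m hm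
      simp only [Set.mem_empty_iff_false, iff_false]
      rintro ⟨i, j, hij, hj, he⟩
      exact hm i (Finset.mem_range.2 (hij.trans hj)) j (Finset.mem_range.2 hj) hij
        (refinedLabel_eq_iff.1 he).2)
  simpa using h

theorem exists_eventually_ordPattern_le_itinerary (hΩc : IsCompact Ω) (hΩ : ∀ᵐ ω ∂μ, ω ∈ Ω)
    (hT : MeasurePreserving T μ μ) (hmaps : Set.MapsTo T Ω Ω) (hap : Aperiodic μ T)
    {M : ℕ → Set ℝ} (hM : IsMonotonyPartition Ω T M) (hfin : eEntropy μ (label M) ≠ ∞)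
    {ε : ℝ} (hε : 0 < ε) :
    ∃ Q : ℝ → ℕ, MeasurableFibers Q ∧ eEntropy μ Q ≠ ∞ ∧
      ∀ᶠ n : ℕ in atTop, (eEntropy μ (ordPattern T n)).toReal / n
        ≤ (eEntropy μ (itinerary T Q n)).toReal / n + ε := by
  have hMl := hM.1.measurableFibers_label fun i => (hM.2 i).1.measurableSet hΩc.measurableSet
  obtain ⟨N, hN⟩ := exists_nat_gt (4 * log 2 / ε)
  have hlog : 0 < log 2 := log_pos one_lt_two
  have hN0 : (0 : ℝ) < N := lt_trans (by positivity) hN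
  have hN0' : 0 < N := Nat.cast_pos.1 hN0
  obtain ⟨m, hm⟩ := ((tendsto_measure_returnSet_refinedLabel hT hap hMl N).eventually_le_const
    (ENNReal.inv_pos.2 (ENNReal.natCast_ne_top N))).exists
  set Q := refinedLabel M m with hQdef
  have hQ : MeasurableFibers Q := measurableFibers_refinedLabel hMl m
  have hQfin : eEntropy μ Q ≠ ∞ := eEntropy_refinedLabel_ne_top hΩc hΩ hMl hfin m
  have hmem : ∀ x ∈ Ω, x ∈ M (label M x) := fun x hx => (hM.1.mem_iff_label_eq hx _).2 rfl
  have hsep : ∀ x ∈ Ω, ∀ y ∈ Ω, ∀ x' ∈ Ω, ∀ y' ∈ Ω, Q x = Q x' → Q y = Q y' → Q x ≠ Q y →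
      x < y → x' < y' := by
    intro x hx y hy x' hx' y' hy' hxx hyy hne hlt
    rw [hQdef, refinedLabel_eq_iff] at hxx hyy
    rw [hQdef, Ne, refinedLabel_eq_iff, not_and_or] at hne
    by_cases hl : label M x = label M y
    · have hne := hne.resolve_left (not_not.2 hl)
      have h₁ : ⌊(m : ℝ) * x⌋ < ⌊(m : ℝ) * y⌋ :=
        (Int.floor_mono (by gcongr)).lt_of_ne hne
      rw [hxx.2, hyy.2] at h₁
      by_contra! hle
      exact h₁.not_ge (Int.floor_mono (by gcongr))
    · exact (hM.2 _).1.lt_of_lt (hM.2 _).1 (hM.1.1 hl) (hmem x hx) (hxx.1 ▸ hmem x' hx')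
        (hmem y hy) (hyy.1 ▸ hmem y' hy') hlt
  have hmono : ∀ i, MonotoneOn T (Ω ∩ Q ⁻¹' {i}) ∨ AntitoneOn T (Ω ∩ Q ⁻¹' {i}) := by
    intro i
    rcases (Ω ∩ Q ⁻¹' {i}).eq_empty_or_nonempty with he | ⟨x, hx, hxi⟩
    · rw [he]
      exact .inl fun _ h => h.elim
    have hsub : Ω ∩ Q ⁻¹' {i} ⊆ M (label M x) := by
      rintro y ⟨hy, hyi⟩
      have he : Q y = Q x := hyi.trans hxi.symm
      rw [← (refinedLabel_eq_iff.1 he).1]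
      exact hmem y hy
    exact (hM.2 (label M x)).2.imp (fun h => h.mono hsub) fun h => h.antitoneOn.mono hsub
  refine ⟨Q, hQ, hQfin, ?_⟩
  have hlim : Tendsto (fun n : ℕ => 2 * log 2 / (n : ℝ)) atTop (nhds 0) :=
    tendsto_const_nhds.div_atTop tendsto_natCast_atTop_atTop
  filter_upwards [hlim.eventually_le_const (half_pos hε), eventually_gt_atTop 0] with n hn hn0
  have hnR : (0 : ℝ) < n := Nat.cast_pos.2 hn0
  obtain ⟨k, rfl⟩ : ∃ k, n = k + 1 := ⟨n - 1, by omega⟩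
  have hk : k ≤ (k / N + 1) * N := by
    rw [Nat.succ_mul]
    have := Nat.div_add_mod' k N
    have := Nat.mod_lt k hN0'
    omega
  have hle := eEntropy_ordPattern_le hΩ hT hmaps hap hQ hsep hmono hk
  have hle₂ : (N : ℝ≥0∞) * μ (returnSet T Q N) ≤ 1 :=
    (mul_le_mul_right hm _).trans (ENNReal.mul_inv_le_one _)
  have hle₃ : ENNReal.ofReal (log 2) * ((k / N + 1 : ℕ) * (1 + N * μ (returnSet T Q N)))
      ≤ ENNReal.ofReal (2 * log 2 * (k / N + 1 : ℕ)) := by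
    have h2 : (1 : ℝ≥0∞) + N * μ (returnSet T Q N) ≤ 2 :=
      (add_le_add le_rfl hle₂).trans_eq one_add_one_eq_two
    refine (mul_le_mul_right (mul_le_mul_right h2 _) _).trans_eq ?_
    rw [ENNReal.ofReal_mul (by positivity), ENNReal.ofReal_mul (by positivity),
      ENNReal.ofReal_natCast, ENNReal.ofReal_ofNat]
    ring
  have hIfin := eEntropy_itinerary_ne_top hT hQ hQfin (k + 1)
  have hle₄ := ENNReal.toReal_mono (ENNReal.add_ne_top.2 ⟨hIfin, ENNReal.ofReal_ne_top⟩)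
    (hle.trans (add_le_add le_rfl hle₃))
  rw [ENNReal.toReal_add hIfin ENNReal.ofReal_ne_top,
    ENNReal.toReal_ofReal (by positivity)] at hle₄
  have hkN : ((k / N + 1 : ℕ) : ℝ) ≤ (k + 1 : ℕ) / N + 1 := by
    push_cast
    have h₁ : ((k / N : ℕ) : ℝ) ≤ k / N := Nat.cast_div_le
    have h₂ : (k : ℝ) / N ≤ (k + 1) / N := by gcongr; linarith
    linarith
  have hNε : 2 * log 2 / N ≤ ε / 2 := by
    rw [div_lt_iff₀ hε] at hN
    rw [div_le_iff₀ hN0]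
    linarith
  rw [div_le_iff₀ hnR] at hn
  rw [div_add' _ _ _ hnR.ne']
  refine div_le_div_of_nonneg_right (hle₄.trans ?_) hnR.le
  have h₅ : 2 * log 2 * (k / N + 1 : ℕ) ≤ 2 * log 2 * ((k + 1 : ℕ) / N + 1) := by gcongr
  have h₆ : 2 * log 2 * (((k + 1 : ℕ) : ℝ) / N + 1)
      = 2 * log 2 / N * (k + 1 : ℕ) + 2 * log 2 := by ring
  have h₇ := mul_le_mul_of_nonneg_right hNε hnR.le
  linarith

end Partitions

theorem stmt9 (Ω : Set ℝ) (hΩc : IsCompact Ω) (μ : Measure ℝ) [IsProbabilityMeasure μ]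
    (hΩ : μ Ω = 1) (T : ℝ → ℝ) (hT : MeasurePreserving T μ μ) (hmaps : Set.MapsTo T Ω Ω)
    (hap : Aperiodic μ T)
    (M : ℕ → Set ℝ) (hM : IsMonotonyPartition Ω T M)
    (hH : Summable fun i => Real.negMulLog (μ (M i)).toReal) :
    permEntropy Ω μ T = ksEntropy Ω μ T := by
  have hΩae : ∀ᵐ ω ∂μ, ω ∈ Ω := (mem_ae_iff_prob_eq_one hΩc.measurableSet).2 hΩ
  have hfib : ∀ {P : ℕ → Set ℝ} {X : ℝ → ℕ}, (∀ ω ∈ Ω, ∀ i, ω ∈ P i ↔ X ω = i) →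
      ∀ i, μ (P i) = μ (X ⁻¹' {i}) := by
    intro P X h i
    refine measure_congr ?_
    filter_upwards [hΩae] with ω hω
    exact propext (h ω hω i)
  have hMfin : eEntropy μ (label M) ≠ ⊤ := by
    rw [eEntropy_eq_ofReal_shEntropy (hfib fun ω hω i => hM.1.mem_iff_label_eq hω i) hH]
    exact ENNReal.ofReal_ne_top
  have hB := fun ε hε => exists_eventually_ordPattern_le_itinerary (ε := ε) hΩc hΩae hT hmaps hap
    hM hMfin hε
  have hperm : permEntropy Ω μ T
      = liminf (fun n : ℕ => (eEntropy μ (ordPattern T n)).toReal / n) atTop := by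
    simp only [permEntropy, shEntropy_ordCell hΩae hT hap]
  obtain ⟨K, hK⟩ : ∃ K, ∀ᶠ n : ℕ in atTop, (eEntropy μ (ordPattern T n)).toReal / n ≤ K := by
    obtain ⟨Q, hQ, hQfin, h⟩ := hB 1 one_pos
    refine ⟨(eEntropy μ Q).toReal + 1, h.mono fun n hn => hn.trans ?_⟩
    have := toReal_eEntropy_itinerary_div_le hT hQ hQfin n
    linarith
  have hrate : ∀ {P : ℕ → Set ℝ} {X : ℝ → ℕ}, (∀ ω ∈ Ω, ∀ i, ω ∈ P i ↔ X ω = i) →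
      entropyRate μ T P = liminf (fun n : ℕ => (eEntropy μ (itinerary T X n)).toReal / n)
        atTop := by
    intro P X h
    simp only [entropyRate, shEntropy_multiCell hΩae hmaps h]
  have hub : ∀ h ∈ {h : ℝ | ∃ P : ℕ → Set ℝ, IsPartitionOf Ω P ∧ (∀ i, MeasurableSet (P i)) ∧
      (Summable fun i => Real.negMulLog (μ (P i)).toReal) ∧ h = entropyRate μ T P},
      h ≤ permEntropy Ω μ T := by
    rintro _ ⟨P, hP, hPm, hPs, rfl⟩
    have hl : ∀ ω ∈ Ω, ∀ i, ω ∈ P i ↔ label P ω = i := fun ω hω i => hP.mem_iff_label_eq hω i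
    have hfin : eEntropy μ (label P) ≠ ⊤ := by
      rw [eEntropy_eq_ofReal_shEntropy (hfib hl) hPs]
      exact ENNReal.ofReal_ne_top
    rw [hperm, hrate hl]
    refine le_of_forall_pos_le_add fun ε hε => liminf_le_liminf_add (fun n => by positivity) hK ?_
    exact eventually_itinerary_le_ordPattern hT (hP.measurableFibers_label hPm) hfin hε
  have hne : ∀ {Q : ℝ → ℕ}, MeasurableFibers Q → eEntropy μ Q ≠ ⊤ →
      liminf (fun n : ℕ => (eEntropy μ (itinerary T Q n)).toReal / n) atTop
        ∈ {h : ℝ | ∃ P : ℕ → Set ℝ, IsPartitionOf Ω P ∧ (∀ i, MeasurableSet (P i)) ∧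
      (Summable fun i => Real.negMulLog (μ (P i)).toReal) ∧ h = entropyRate μ T P} := by
    intro Q hQ hQfin
    have hl : ∀ ω ∈ Ω, ∀ i, ω ∈ Ω ∩ Q ⁻¹' {i} ↔ Q ω = i := fun ω hω i => by simp [hω]
    refine ⟨fun i => Ω ∩ Q ⁻¹' {i}, ⟨?_, ?_⟩, fun i => hΩc.measurableSet.inter (hQ i), ?_,
      (hrate hl).symm⟩
    · intro i j hij
      refine Set.disjoint_left.2 fun ω h₁ h₂ => hij ?_
      exact h₁.2.symm.trans h₂.2
    · ext ω
      simp
    · have := ENNReal.summable_toReal hQfin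
      refine this.congr fun i => ?_
      rw [ENNReal.toReal_ofReal (negMulLog_nonneg measureReal_nonneg measureReal_le_one),
        measureReal_def, hfib hl i]
  refine le_antisymm ?_ ?_
  · refine le_of_forall_pos_le_add fun ε hε => ?_
    obtain ⟨Q, hQ, hQfin, h⟩ := hB ε hε
    rw [hperm]
    refine (liminf_le_liminf_add (fun n => by positivity)
      (.of_forall fun n => toReal_eEntropy_itinerary_div_le hT hQ hQfin n) h).trans ?_
    gcongr
    exact le_csSup ⟨_, hub⟩ (hne hQ hQfin)
  · obtain ⟨Q, hQ, hQfin, -⟩ := hB 1 one_pos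
    exact csSup_le ⟨_, hne hQ hQfin⟩ hub
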